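/- With T the 3×3 integer matrix with rows (3,1,0), (1,0,0), (0,0,1), one has T·h = −2·√3·2^(1/3)·h*, T·g = (√3·2^(1/3)/2)·(−g* − √3·k*), and T·k = (√3·2^(1/3)/2)·(√3·g* − k*), where h* = g × k, g* = h × k, k* = h × g. -/

import Mathlib

open Matrix

noncomputable def cbrt2 : ℝ := (2 : ℝ) ^ ((1 : ℝ) / 3)
noncomputable def cbrt4 : ℝ := (2 : ℝ) ^ ((2 : ℝ) / 3)

def T : Matrix (Fin 3) (Fin 3) ℝ := !![3, 1, 0; 1, 0, 0; 0, 0, 1]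

noncomputable def h : Fin 3 → ℝ :=
  (1 / 6 : ℝ) • ![cbrt2, 2 - 2 * cbrt2 + cbrt4, -cbrt2 + cbrt4]

noncomputable def g : Fin 3 → ℝ :=
  (1 / 12 : ℝ) • ![-cbrt2, 4 + 2 * cbrt2 - cbrt4, cbrt2 - cbrt4]

noncomputable def k : Fin 3 → ℝ :=
  (Real.sqrt 3 / 12) • ![cbrt2, -2 * cbrt2 - cbrt4, -cbrt2 - cbrt4]

noncomputable def hstar : Fin 3 → ℝ := crossProduct g k
noncomputable def gstar : Fin 3 → ℝ := crossProduct h k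
noncomputable def kstar : Fin 3 → ℝ := crossProduct h g

theorem cbrt2_pow_three : cbrt2 ^ 3 = 2 := by
  rw [cbrt2, ← Real.rpow_natCast, ← Real.rpow_mul zero_le_two]
  norm_num

theorem cbrt4_eq_cbrt2_sq : cbrt4 = cbrt2 ^ 2 := by
  rw [cbrt2, cbrt4, ← Real.rpow_natCast, ← Real.rpow_mul zero_le_two]
  norm_num

theorem T_connects_eigenbasis_with_conjugate_eigenbasis :
    T.mulVec h = (-2 * Real.sqrt 3 * cbrt2) • hstar ∧
    T.mulVec g = (Real.sqrt 3 * cbrt2 / 2) • (-gstar - Real.sqrt 3 • kstar) ∧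
    T.mulVec k = (Real.sqrt 3 * cbrt2 / 2) • (Real.sqrt 3 • gstar - kstar) := by
  have hs : Real.sqrt 3 ^ 2 = 3 := Real.sq_sqrt zero_le_three
  have hc := cbrt2_pow_three
  refine ⟨?_, ?_, ?_⟩ <;> ext i <;> fin_cases i <;>
    simp [T, h, g, k, hstar, gstar, kstar, crossProduct, Matrix.mulVec, dotProduct,
      Fin.sum_univ_three, cbrt4_eq_cbrt2_sq] <;>
    grind
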